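/- Let θ be a positive irrational number. Every best approximation from above of the third kind to θ is either the fraction ⌈θ⌉/1 or a convergent of the regular continued fraction expansion of θ. -/

import Mathlib

/-- The coefficients `a₀, a₁, a₂, …` of the regular continued fraction expansion of `θ`. -/
noncomputable def cfA : ℝ → ℕ → ℤ
  | θ, 0 => ⌊θ⌋
  | θ, n + 1 => cfA (Int.fract θ)⁻¹ n

/-- Numerators of the convergents, shifted by one: `cfP θ (n+1) = pₙ`, with
`p₋₁ = 1`, `p₀ = a₀` and `pₙ = aₙ pₙ₋₁ + pₙ₋₂`. -/
noncomputable def cfP (θ : ℝ) : ℕ → ℤ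
  | 0 => 1
  | 1 => ⌊θ⌋
  | n + 2 => cfA θ (n + 1) * cfP θ (n + 1) + cfP θ n

/-- Denominators of the convergents, shifted by one: `cfQ θ (n+1) = qₙ`, with
`q₋₁ = 0`, `q₀ = 1` and `qₙ = aₙ qₙ₋₁ + qₙ₋₂`. -/
noncomputable def cfQ (θ : ℝ) : ℕ → ℤ
  | 0 => 0
  | 1 => 1
  | n + 2 => cfA θ (n + 1) * cfQ θ (n + 1) + cfQ θ n

/-- `p/q` (with `q > 0`) is a best approximation from above of the third kind to `θ`. -/
def IsBestAboveThird (θ : ℝ) (p q : ℤ) : Prop :=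
  0 < q ∧ 0 ≤ (q : ℝ) * ((p : ℝ) - (q : ℝ) * θ) ∧
    ∀ p' q' : ℤ, 0 < q' → q' ≤ q → θ ≤ (p' : ℝ) / (q' : ℝ) →
      (p' : ℝ) / (q' : ℝ) ≠ (p : ℝ) / (q : ℝ) →
      (q : ℝ) * ((p : ℝ) - (q : ℝ) * θ) < (q' : ℝ) * ((p' : ℝ) - (q' : ℝ) * θ)

/-- The complete quotients of the continued fraction expansion of `θ`. -/
noncomputable def completeQuotient (θ : ℝ) : ℕ → ℝ
  | 0 => θ
  | n + 1 => (Int.fract (completeQuotient θ n))⁻¹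

theorem completeQuotient_fract_inv (θ : ℝ) (n : ℕ) :
    completeQuotient (Int.fract θ)⁻¹ n = completeQuotient θ (n + 1) := by
  induction n with
  | zero => rfl
  | succ n ih => exact congrArg (fun x => (Int.fract x)⁻¹) ih

theorem cfA_eq_floor_completeQuotient (θ : ℝ) (n : ℕ) :
    cfA θ n = ⌊completeQuotient θ n⌋ := by
  induction n generalizing θ with
  | zero => rfl
  | succ n ih => rw [cfA, ih, completeQuotient_fract_inv]

theorem irrational_fract {x : ℝ} (hx : Irrational x) : Irrational (Int.fract x) :=
  hx.sub_intCast ⌊x⌋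

theorem irrational_completeQuotient {θ : ℝ} (hθ : Irrational θ) (n : ℕ) :
    Irrational (completeQuotient θ n) := by
  induction n with
  | zero => exact hθ
  | succ n ih => exact irrational_inv_iff.mpr (irrational_fract ih)

theorem fract_completeQuotient_pos {θ : ℝ} (hθ : Irrational θ) (n : ℕ) :
    0 < Int.fract (completeQuotient θ n) :=
  (Int.fract_nonneg _).lt_of_ne' (irrational_fract (irrational_completeQuotient hθ n)).ne_zero

theorem one_le_cfA_succ {θ : ℝ} (hθ : Irrational θ) (n : ℕ) : 1 ≤ cfA θ (n + 1) := by
  rw [cfA_eq_floor_completeQuotient, Int.le_floor, completeQuotient, Int.cast_one]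
  exact (one_le_inv₀ (fract_completeQuotient_pos hθ n)).mpr (Int.fract_lt_one _).le

theorem cfQ_nonneg_and_pos_succ_and_le_succ {θ : ℝ} (hθ : Irrational θ) (n : ℕ) :
    0 ≤ cfQ θ n ∧ 1 ≤ cfQ θ (n + 1) ∧ cfQ θ n ≤ cfQ θ (n + 1) := by
  induction n with
  | zero => simp [cfQ]
  | succ n ih =>
    obtain ⟨h0, h1, -⟩ := ih
    have ha := one_le_cfA_succ hθ n
    have hrec : cfQ θ (n + 2) = cfA θ (n + 1) * cfQ θ (n + 1) + cfQ θ n := rfl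
    refine ⟨by lia, ?_, ?_⟩ <;> rw [hrec] <;> nlinarith

theorem natCast_le_cfQ_two_mul {θ : ℝ} (hθ : Irrational θ) (k : ℕ) :
    (k : ℤ) ≤ cfQ θ (2 * k) := by
  induction k with
  | zero => simp [cfQ]
  | succ k ih =>
    have h1 := (cfQ_nonneg_and_pos_succ_and_le_succ hθ (2 * k)).2.1
    have ha := one_le_cfA_succ hθ (2 * k)
    have hrec : cfQ θ (2 * (k + 1)) =
      cfA θ (2 * k + 1) * cfQ θ (2 * k + 1) + cfQ θ (2 * k) := rfl
    rw [hrec]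
    push_cast
    nlinarith

theorem cfP_mul_cfQ_sub (θ : ℝ) (n : ℕ) :
    cfP θ n * cfQ θ (n + 1) - cfP θ (n + 1) * cfQ θ n = (-1) ^ n := by
  induction n with
  | zero => simp [cfP, cfQ]
  | succ n ih =>
    rw [cfP, cfQ, pow_succ, ← ih]
    ring

/-- Consecutive errors `qₙ θ - pₙ` have ratio minus the complete quotient. -/
theorem cfQ_mul_sub_cfP_eq {θ : ℝ} (hθ : Irrational θ) (n : ℕ) :
    (cfQ θ n : ℝ) * θ - cfP θ n =
      -completeQuotient θ (n + 1) * (cfQ θ (n + 1) * θ - cfP θ (n + 1)) := by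
  induction n with
  | zero =>
    have h := (fract_completeQuotient_pos hθ 0).ne'
    simp only [completeQuotient] at h ⊢
    simp only [cfP, cfQ, Int.cast_one, Int.cast_zero, one_mul, zero_mul]
    change _ = -(Int.fract θ)⁻¹ * Int.fract θ
    field_simp
    simp
  | succ n ih =>
    have h := (fract_completeQuotient_pos hθ (n + 1)).ne'
    have hfl := Int.floor_add_fract (completeQuotient θ (n + 1))
    rw [← cfA_eq_floor_completeQuotient] at hfl
    have hstep : (cfQ θ (n + 2) : ℝ) * θ - cfP θ (n + 2) =
        -Int.fract (completeQuotient θ (n + 1)) * (cfQ θ (n + 1) * θ - cfP θ (n + 1)) := by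
      rw [cfQ, cfP]
      push_cast
      linear_combination ih + (cfQ θ (n + 1) * θ - cfP θ (n + 1)) * hfl
    have hsucc : completeQuotient θ (n + 2) = (Int.fract (completeQuotient θ (n + 1)))⁻¹ := rfl
    rw [hstep, hsucc]
    field_simp

theorem neg_one_pow_mul_cfP_sub_pos {θ : ℝ} (hθ : Irrational θ) (n : ℕ) :
    0 < (-1 : ℝ) ^ n * (cfP θ n - cfQ θ n * θ) := by
  induction n with
  | zero => simp [cfP, cfQ]
  | succ n ih =>
    have hT : 0 < completeQuotient θ (n + 1) := inv_pos.mpr (fract_completeQuotient_pos hθ n)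
    refine pos_of_mul_pos_right (ih.trans_eq ?_) hT.le
    rw [pow_succ]
    linear_combination -(-1 : ℝ) ^ n * cfQ_mul_sub_cfP_eq hθ n

/-- The upper convergents and the denominators trapping a given positive integer. -/
theorem exists_cfQ_two_mul_le_and_lt {θ : ℝ} (hθ : Irrational θ) {q : ℤ} (hq : 0 < q) :
    ∃ k : ℕ, cfQ θ (2 * k) ≤ q ∧ q < cfQ θ (2 * k + 2) := by
  have hex : ∃ k : ℕ, q < cfQ θ (2 * k + 2) := by
    refine ⟨q.toNat, ?_⟩
    have := natCast_le_cfQ_two_mul hθ (q.toNat + 1)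
    rw [mul_add, mul_one] at this
    push_cast at this
    lia
  refine ⟨Nat.find hex, ?_, Nat.find_spec hex⟩
  rcases hk : Nat.find hex with _ | k
  · simpa [cfQ] using hq.le
  · exact not_lt.mp (Nat.find_min hex (m := k) (by lia))

/-- In coordinates `x`, `y` with respect to two consecutive convergents, the product of denominator
and error is at least that of the first one, as long as `y` is less than the next coefficient. -/
theorem mul_le_combination_mul_combination {Q Q' δ ε x y a : ℝ} (hQ : 0 ≤ Q) (hQQ' : Q ≤ Q')
    (hδ : 0 ≤ δ) (hε : 0 ≤ ε) (hx : 1 ≤ x) (hy : 0 ≤ y) (hya : y + 1 ≤ a) (haδ : a * ε ≤ δ) :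
    Q * δ ≤ (x * Q + y * Q') * (x * δ - y * ε) := by
  have hyε : (y + 1) * ε ≤ δ := (mul_le_mul_of_nonneg_right hya hε).trans haδ
  calc Q * δ ≤ (Q + y * Q') * (δ - y * ε) := by
        have h1 : Q' * ((y + 1) * ε) ≤ Q' * δ :=
          mul_le_mul_of_nonneg_left hyε (hQ.trans hQQ')
        have h2 : Q * ε ≤ Q' * ε := mul_le_mul_of_nonneg_right hQQ' hε
        nlinarith [mul_nonneg hy (show 0 ≤ Q' * δ - Q * ε - y * Q' * ε by linarith)]
    _ ≤ (x * Q + y * Q') * (x * δ - y * ε) := by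
        have hQ' : 0 ≤ y * Q' := mul_nonneg hy (hQ.trans hQQ')
        apply mul_le_mul
        · nlinarith
        · nlinarith
        · nlinarith
        · nlinarith

theorem bestAboveThird_is_ceil_or_convergent (θ : ℝ) (hθpos : 0 < θ)
    (hθ : Irrational θ) (p q : ℤ) (h : IsBestAboveThird θ p q) :
    (p : ℝ) / (q : ℝ) = (⌈θ⌉ : ℝ) ∨
      ∃ n : ℕ, (p : ℝ) / (q : ℝ) = (cfP θ (n + 1) : ℝ) / (cfQ θ (n + 1) : ℝ) := by
  obtain ⟨hq, habove, hbest⟩ := h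
  by_contra! hne
  obtain ⟨hceil, hconv⟩ := hne
  obtain ⟨k, hk, hk'⟩ := exists_cfQ_two_mul_le_and_lt hθ hq
  have hdet := cfP_mul_cfQ_sub θ (2 * k)
  rw [pow_mul, neg_one_sq, one_pow] at hdet
  have hδ := neg_one_pow_mul_cfP_sub_pos hθ (2 * k)
  rw [pow_mul, neg_one_sq, one_pow, one_mul] at hδ
  have hε := neg_one_pow_mul_cfP_sub_pos hθ (2 * k + 1)
  rw [pow_succ, pow_mul, neg_one_sq, one_pow, one_mul, neg_one_mul, neg_sub] at hε
  have hδ₂ := neg_one_pow_mul_cfP_sub_pos hθ (2 * k + 2)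
  rw [pow_add, pow_mul, neg_one_sq, one_pow, one_mul, one_mul] at hδ₂
  obtain ⟨hQ, hQ', hQQ'⟩ := cfQ_nonneg_and_pos_succ_and_le_succ hθ (2 * k)
  have hrecQ : cfQ θ (2 * k + 2) =
    cfA θ (2 * k + 1) * cfQ θ (2 * k + 1) + cfQ θ (2 * k) := rfl
  have hrecP : cfP θ (2 * k + 2) =
    cfA θ (2 * k + 1) * cfP θ (2 * k + 1) + cfP θ (2 * k) := rfl
  set a := cfA θ (2 * k + 1)
  set δ := (cfP θ (2 * k) : ℝ) - cfQ θ (2 * k) * θ with hδ_def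
  set ε := (cfQ θ (2 * k + 1) : ℝ) * θ - cfP θ (2 * k + 1) with hε_def
  have haδ : (a : ℝ) * ε ≤ δ := by
    rw [hrecQ, hrecP] at hδ₂
    push_cast at hδ₂
    linarith
  obtain ⟨x, hx⟩ : ∃ x, x = p * cfQ θ (2 * k + 1) - q * cfP θ (2 * k + 1) := ⟨_, rfl⟩
  obtain ⟨y, hy⟩ : ∃ y, y = q * cfP θ (2 * k) - p * cfQ θ (2 * k) := ⟨_, rfl⟩
  have hp_eq : p = x * cfP θ (2 * k) + y * cfP θ (2 * k + 1) := by
    rw [hx, hy]; linear_combination -p * hdet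
  have hq_eq : q = x * cfQ θ (2 * k) + y * cfQ θ (2 * k + 1) := by
    rw [hx, hy]; linear_combination -q * hdet
  have hp_eqR : (p : ℝ) = x * cfP θ (2 * k) + y * cfP θ (2 * k + 1) := mod_cast hp_eq
  have hq_eqR : (q : ℝ) = x * cfQ θ (2 * k) + y * cfQ θ (2 * k + 1) := mod_cast hq_eq
  have herr : (p : ℝ) - q * θ = x * δ - y * ε := by
    rw [hp_eqR, hq_eqR, hδ_def, hε_def]; ring
  have hqR : (0 : ℝ) < q := mod_cast hq
  have herr_nonneg : 0 ≤ (x : ℝ) * δ - y * ε := herr ▸ nonneg_of_mul_nonneg_right habove hqR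
  have hx1 : 1 ≤ x := by
    by_contra! hx0
    have hy1 : 1 ≤ y := by
      by_contra! hy0
      nlinarith
    have hx0R : (x : ℝ) ≤ 0 := by exact_mod_cast Int.lt_add_one_iff.mp hx0
    have hy1R : (1 : ℝ) ≤ y := mod_cast hy1
    nlinarith
  have hx1R : (1 : ℝ) ≤ x := mod_cast hx1
  have hya : y + 1 ≤ a := by
    by_contra! hya
    nlinarith
  have hyaR : (y : ℝ) + 1 ≤ a := mod_cast hya
  rcases k with _ | k
  · have hε_eq : ε = θ - ⌊θ⌋ := by simp [hε_def, cfP, cfQ]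
    have hδ_eq : δ = 1 := by simp [hδ_def, cfP, cfQ]
    have hyq : y = q := by simp [hy, cfP, cfQ]
    have hlt := hbest ⌈θ⌉ 1 one_pos hq (by simpa using Int.le_ceil θ) (by simpa using hceil.symm)
    have hle : (⌈θ⌉ : ℝ) ≤ ⌊θ⌋ + 1 := mod_cast Int.ceil_le_floor_add_one θ
    have hq1R : (1 : ℝ) ≤ q := mod_cast hq
    rw [herr, hδ_eq, hyq] at hlt
    rw [hyq] at hyaR
    rw [hδ_eq] at haδ
    push_cast at hlt
    have hqε : ((q : ℝ) + 1) * ε ≤ 1 := (mul_le_mul_of_nonneg_right hyaR hε.le).trans haδ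
    nlinarith [mul_nonneg (sub_nonneg.mpr hq1R) (sub_nonneg.mpr hqε)]
  · have hQpos : 0 < cfQ θ (2 * (k + 1)) := by
      have := natCast_le_cfQ_two_mul hθ (k + 1)
      lia
    have hQposR : (0 : ℝ) < cfQ θ (2 * (k + 1)) := mod_cast hQpos
    have hlt := hbest (cfP θ (2 * (k + 1))) _ hQpos hk
      (by rw [le_div_iff₀ hQposR]; linarith) (hconv (2 * k + 1)).symm
    rw [herr, ← hδ_def] at hlt
    refine hlt.not_ge ?_
    rcases le_total 0 y with hy0 | hy0
    · rw [hq_eqR]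
      exact mul_le_combination_mul_combination hQposR.le (mod_cast hQQ') hδ.le hε.le hx1R
        (mod_cast hy0) hyaR haδ
    · have hy0R : (y : ℝ) ≤ 0 := mod_cast hy0
      have hkR : (cfQ θ (2 * (k + 1)) : ℝ) ≤ q := mod_cast hk
      exact mul_le_mul hkR (by nlinarith) hδ.le hqR.le
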